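/- Let q ≡ 1 (mod 12) be a prime power, q = p^n with p > 3, and let E: y^2 = x^3 + a x + b be an elliptic curve over F_q with a, b ≠ 0 and j(E) ≠ 0, 1728. Then the trace of Frobenius satisfies a_q(E) = −q·T^{(q−1)/4}(a^3/27) · ₂F₁(T^{(q−1)/12}, T^{5(q−1)/12}; φ | −27b^2/(4a^3)), where T is a fixed generator of the character group of F_q*, φ the quadratic character, and ₂F₁ is Greene's Gaussian hypergeometric series. -/

import Mathlib

/-- Greene`s binomial coefficient `binom(A,B) = (B(-1)/q)·J(A, B̄)`. -/
noncomputable def greeneBinom (F : Type) [Field F] [Fintype F] (A B : MulChar F ℂ) : ℂ :=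
  B (-1) / (Fintype.card F : ℂ) * jacobiSum A B⁻¹

/-- Greene`s Gaussian hypergeometric series `₂F₁(A,B;C|x)`, with the sum over all
multiplicative characters written as `χ = T^m` for a generator `T`. -/
noncomputable def hyp2F1 (F : Type) [Field F] [Fintype F] (q : ℕ)
    (T A B C : MulChar F ℂ) (x : F) : ℂ :=
  (q : ℂ) / ((q : ℂ) - 1) *
    ∑ m ∈ Finset.range (q - 1),
      greeneBinom F (A * T ^ m) (T ^ m) * greeneBinom F (B * T ^ m) (C * T ^ m) * (T ^ m) x

section

open Finset

section counting

variable {F : Type*} [Field F]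

theorem MulChar.exists_eq_pow_orderOf [Finite F] (χ : MulChar F ℂ) {u : F} (hu : u ≠ 0)
    (h : χ u = 1) : ∃ v, u = v ^ orderOf χ := by
  obtain ⟨g, hg⟩ := IsCyclic.exists_generator (α := Fˣ)
  obtain ⟨k, hk⟩ := mem_powers_iff_mem_zpowers.mpr (hg (Units.mk0 u hu))
  have hk : g ^ k = Units.mk0 u hu := hk
  have hk' : (g : F) ^ k = u := by
    rw [← Units.val_pow_eq_pow_val, hk, Units.val_mk0]
  have : χ ^ k = 1 := by
    rw [MulChar.eq_iff hg, MulChar.pow_apply_coe, ← map_pow, hk', h, MulChar.one_apply_coe]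
  obtain ⟨m, rfl⟩ := orderOf_dvd_of_pow_eq_one this
  exact ⟨(g : F) ^ m, by rw [← hk', ← pow_mul, mul_comm]⟩

theorem MulChar.apply_pow_orderOf (χ : MulChar F ℂ) {v : F} (hv : v ≠ 0) :
    χ (v ^ orderOf χ) = 1 := by
  have h := MulChar.pow_apply_coe χ (orderOf χ) (Units.mk0 v hv)
  rw [pow_orderOf_eq_one, MulChar.one_apply_coe] at h
  rw [map_pow]
  exact h.symm

theorem MulChar.apply_pow_orderOf_eq_one (χ : MulChar F ℂ) {v : F} (hv : v ≠ 0) :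
    χ v ^ orderOf χ = 1 := by
  rw [← map_pow, χ.apply_pow_orderOf hv]

theorem MulChar.ne_one_of_orderOf {χ : MulChar F ℂ} {n : ℕ} (h : orderOf χ = n) (hn : n ≠ 1) :
    χ ≠ 1 := by
  rintro rfl
  exact hn (by rw [← h, orderOf_one])

theorem MulChar.apply_sq_of_orderOf_eq_two [Finite F] {φ : MulChar F ℂ} (hφ : orderOf φ = 2)
    {x : F} (hx : x ≠ 0) : φ (x ^ 2) = 1 := by
  rw [← hφ, φ.apply_pow_orderOf hx]

theorem fiber_ne {s u : F} (hs : s ≠ 0) (hu : u / (1 + u) ^ 2 = s) : u ≠ 0 ∧ 1 + u ≠ 0 := by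
  constructor <;> intro h <;> simp [h, eq_comm] at hu <;> exact hs hu

theorem root_ne {s x : F} (hs : s ≠ 0) (hx : (27 * x * (1 - x) ^ 2)⁻¹ = s) :
    x ≠ 0 ∧ 1 - x ≠ 0 := by
  constructor <;> intro h <;> simp [h, eq_comm] at hx <;> exact hs hx

theorem root_eq {s x : F} (hs : s ≠ 0) (hx : (27 * x * (1 - x) ^ 2)⁻¹ = s) :
    27 * s * x * (1 - x) ^ 2 = 1 := by
  have h : 27 * x * (1 - x) ^ 2 ≠ 0 := by
    intro h
    rw [h, inv_zero] at hx
    exact hs hx.symm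
  rw [← hx]
  linear_combination inv_mul_cancel₀ h

theorem discriminant_eq (h3 : (3 : F) ≠ 0) {s x : F} (hs : s ≠ 0)
    (hx : (27 * x * (1 - x) ^ 2)⁻¹ = s) :
    1 - 4 * s = 3 * x * (3 * x - 4) * ((3 * x - 1) / (9 * x * (1 - x))) ^ 2 := by
  obtain ⟨h0, h1⟩ := root_ne hs hx
  have h27 : (27 : F) = 3 ^ 3 := by norm_num
  have h9 : (9 : F) = 3 ^ 2 := by norm_num
  rw [← hx, h27, h9]
  field_simp
  ring

variable [Fintype F]

theorem apply_discriminant {φ : MulChar F ℂ} (hφ : orderOf φ = 2) (h3 : (3 : F) ≠ 0) {s x : F}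
    (hs : s ≠ 0) (h4 : 1 - 4 * s ≠ 0) (hx : (27 * x * (1 - x) ^ 2)⁻¹ = s) :
    φ (3 * x * (3 * x - 4)) = φ (1 - 4 * s) := by
  have h := discriminant_eq h3 hs hx
  rw [h, map_mul φ (3 * x * (3 * x - 4)), MulChar.apply_sq_of_orderOf_eq_two hφ, mul_one]
  intro h'
  rw [h'] at h
  simp at h
  exact h4 h

variable [DecidableEq F]

theorem card_sq_eq {φ : MulChar F ℂ} (hφ : orderOf φ = 2) (h2 : (2 : F) ≠ 0) (s : F) :
    (#{y : F | y ^ 2 = s} : ℂ) = 1 + φ s := by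
  rcases eq_or_ne s 0 with rfl | hs
  · have : ({y : F | y ^ 2 = 0} : Finset F) = {0} := by ext; simp
    rw [this]; simp [MulChar.map_zero]
  by_cases h : φ s = 1
  · obtain ⟨v, rfl⟩ := φ.exists_eq_pow_orderOf hs h
    rw [hφ] at *
    have hv : v ≠ 0 := by rintro rfl; simp at hs
    have : ({y : F | y ^ 2 = v ^ 2} : Finset F) = {v, -v} := by
      ext; simp [sq_eq_sq_iff_eq_or_eq_neg]
    rw [this, h, card_pair]
    · norm_num
    · intro h'
      apply hv
      have : 2 * v = 0 := by linear_combination h'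
      simpa [h2] using this
  · have h1 := φ.apply_pow_orderOf_eq_one hs
    rw [hφ] at h1
    replace h1 := (sq_eq_sq_iff_eq_or_eq_neg.mp (h1.trans (one_pow 2).symm)).resolve_left h
    rw [h1, filter_eq_empty_iff.mpr]
    · simp
    · intro y _ hy
      apply h
      rw [← hy, ← hφ, φ.apply_pow_orderOf]
      rintro rfl
      simp [← hy] at hs

theorem card_quadratic_eq {φ : MulChar F ℂ} (hφ : orderOf φ = 2) (h2 : (2 : F) ≠ 0) {a : F}
    (ha : a ≠ 0) (b c : F) :
    (#{y : F | a * y ^ 2 + b * y + c = 0} : ℂ) = 1 + φ (b ^ 2 - 4 * a * c) := by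
  have h4 : (4 : F) ≠ 0 := by
    have : (4 : F) = 2 * 2 := by norm_num
    simp [this, h2]
  rw [← card_sq_eq hφ h2, Nat.cast_inj]
  refine card_bij' (fun y _ ↦ 2 * a * y + b) (fun z _ ↦ (z - b) / (2 * a)) ?_ ?_ ?_ ?_
  · simp only [mem_filter_univ]
    intro y hy
    linear_combination 4 * a * hy
  · simp only [mem_filter_univ]
    intro z hz
    field_simp
    linear_combination hz
  · intro y _
    field_simp
    ring
  · intro z _
    field_simp
    ring

theorem exists_cube_root_of_unity {ω : MulChar F ℂ} (hω : orderOf ω = 3) :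
    ∃ ζ : F, ζ ^ 2 + ζ + 1 = 0 := by
  have h : 3 ∣ Fintype.card Fˣ := by
    rw [Fintype.card_units, ← hω]
    exact ω.orderOf_dvd_card_sub_one
  have : Fact (Nat.Prime 3) := ⟨Nat.prime_three⟩
  obtain ⟨z, hz⟩ := exists_prime_orderOf_dvd_card 3 h
  have h3 : (z : F) ^ 3 = 1 := by
    rw [← Units.val_pow_eq_pow_val, ← hz, pow_orderOf_eq_one, Units.val_one]
  have h1 : (z : F) - 1 ≠ 0 := by
    intro h
    have : z = 1 := Units.ext (by simpa [sub_eq_zero] using h)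
    simp [this] at hz
  refine ⟨z, mul_left_cancel₀ h1 ?_⟩
  linear_combination h3

theorem card_cube_eq {ω : MulChar F ℂ} (hω : orderOf ω = 3) (h3 : (3 : F) ≠ 0) {u : F}
    (hu : u ≠ 0) :
    (#{v : F | v ^ 3 = u} : ℂ) = 1 + ω u + ω u⁻¹ := by
  have hne : ω u ≠ 0 := by rwa [Ne, MulChar.apply_eq_zero_iff, isUnit_iff_ne_zero, not_not]
  rw [← MulChar.inv_apply', MulChar.inv_apply_eq_inv']
  by_cases h : ω u = 1
  · obtain ⟨ζ, hζ⟩ := exists_cube_root_of_unity hω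
    obtain ⟨v, rfl⟩ := ω.exists_eq_pow_orderOf hu h
    rw [hω] at hu h hne ⊢
    have hv : v ≠ 0 := by rintro rfl; simp at hu
    have hζ1 : ζ - 1 ≠ 0 := by
      intro h
      rw [sub_eq_zero] at h
      rw [h] at hζ
      norm_num at hζ
      exact h3 hζ
    have hζ0 : ζ ≠ 0 := by
      rintro rfl
      simp at hζ
    have : ({y : F | y ^ 3 = v ^ 3} : Finset F) = {v, v * ζ, v * ζ ^ 2} := by
      ext y
      simp only [mem_filter_univ, mem_insert, mem_singleton]
      have : y ^ 3 = v ^ 3 ↔ (y - v) * ((y - v * ζ) * (y - v * ζ ^ 2)) = 0 := by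
        rw [← sub_eq_zero]
        have : y ^ 3 - v ^ 3 = (y - v) * ((y - v * ζ) * (y - v * ζ ^ 2)) := by
          linear_combination (y - v) * (y * v - v ^ 2 * (ζ - 1)) * hζ
        rw [this]
      rw [this]
      simp [sub_eq_zero]
    rw [this, h, card_eq_three.mpr]
    · norm_num
    · refine ⟨_, _, _, ?_, ?_, ?_, rfl⟩
      · intro h
        apply hζ1
        apply mul_left_cancel₀ hv
        linear_combination -h
      · intro h
        apply hζ1
        apply mul_left_cancel₀ hv
        linear_combination ζ * h + v * (ζ - 1) * hζ
      · intro h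
        apply hζ1
        have : v * (ζ * (ζ - 1)) = 0 := by linear_combination -h
        simpa [hv, hζ0] using this
  · have h1 := ω.apply_pow_orderOf_eq_one hu
    rw [hω] at h1
    rw [filter_eq_empty_iff.mpr]
    · have : (ω u - 1) * (1 + ω u + (ω u)⁻¹) = 0 := by
        field_simp
        linear_combination h1
      rw [Finset.card_empty, Nat.cast_zero,
        (mul_eq_zero.mp this).resolve_left (sub_ne_zero.mpr h)]
    · intro y _ hy
      apply h
      rw [← hy, ← hω, ω.apply_pow_orderOf]
      rintro rfl
      simp [← hy] at hu

theorem sum_inv_fiber_eq (ω : MulChar F ℂ) (s : F) :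
    ∑ u : F with u / (1 + u) ^ 2 = s, ω u⁻¹ = ∑ u : F with u / (1 + u) ^ 2 = s, ω u := by
  have key (u : F) (hu : u / (1 + u) ^ 2 = s) : u⁻¹ / (1 + u⁻¹) ^ 2 = s := by
    rcases eq_or_ne u 0 with rfl | h
    · simpa using hu
    rw [← hu, show 1 + u⁻¹ = (1 + u) / u by field_simp; ring, div_pow, div_div_eq_mul_div]
    congr 1
    field_simp
  refine sum_bij' (fun u _ ↦ u⁻¹) (fun u _ ↦ u⁻¹) ?_ ?_ ?_ ?_ ?_
  · simpa using key
  · simpa using key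
  all_goals simp

theorem card_fiber_eq {φ : MulChar F ℂ} (hφ : orderOf φ = 2) (h2 : (2 : F) ≠ 0) {s : F}
    (hs : s ≠ 0) : (#{u : F | u / (1 + u) ^ 2 = s} : ℂ) = 1 + φ (1 - 4 * s) := by
  have : ({u : F | u / (1 + u) ^ 2 = s} : Finset F) =
      ({u : F | s * u ^ 2 + (2 * s - 1) * u + s = 0} : Finset F) := by
    ext u
    simp only [mem_filter_univ]
    constructor
    · intro hu
      have h := (fiber_ne hs hu).2
      rw [div_eq_iff (by positivity)] at hu
      linear_combination -hu
    · intro hu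
      have h : 1 + u ≠ 0 := by
        intro h
        have h' : u = -1 := by linear_combination h
        rw [h'] at hu
        exact one_ne_zero (α := F) (by linear_combination hu)
      rw [div_eq_iff (by positivity)]
      linear_combination -hu
  rw [this, card_quadratic_eq hφ h2 hs]
  ring_nf

theorem sum_card_cubes {ω : MulChar F ℂ} (hω : orderOf ω = 3) (h3 : (3 : F) ≠ 0) {s : F}
    (hs : s ≠ 0) : (#{v : F | v ^ 3 / (1 + v ^ 3) ^ 2 = s} : ℂ) =
      #{u : F | u / (1 + u) ^ 2 = s} + 2 * ∑ u : F with u / (1 + u) ^ 2 = s, ω u := by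
  rw [card_eq_sum_card_fiberwise (f := fun v ↦ v ^ 3) (t := {u : F | u / (1 + u) ^ 2 = s})
    (by intro v; simp)]
  push_cast
  trans ∑ u : F with u / (1 + u) ^ 2 = s, (1 + ω u + ω u⁻¹)
  · refine sum_congr rfl fun u hu ↦ ?_
    rw [mem_filter_univ] at hu
    rw [← card_cube_eq hω h3 (fiber_ne hs hu).1, filter_filter]
    congr 2
    ext v
    simp only [mem_filter_univ]
    constructor
    · exact fun h ↦ h.2
    · rintro rfl
      exact ⟨hu, rfl⟩
  · rw [sum_add_distrib, sum_add_distrib, sum_inv_fiber_eq]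
    simp
    ring

theorem sum_card_roots {φ : MulChar F ℂ} (hφ : orderOf φ = 2) (h2 : (2 : F) ≠ 0)
    (h3 : (3 : F) ≠ 0) {s : F} (hs : s ≠ 0) :
    (#{v : F | v ^ 3 / (1 + v ^ 3) ^ 2 = s} : ℂ) =
      ∑ x : F with (27 * x * (1 - x) ^ 2)⁻¹ = s, (1 + φ (3 * x * (3 * x - 4))) := by
  have hne (v : F) (hv : v ^ 3 / (1 + v ^ 3) ^ 2 = s) : v ≠ 0 ∧ 1 + v ^ 3 ≠ 0 := by
    refine ⟨?_, (fiber_ne hs hv).2⟩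
    rintro rfl
    simp [eq_comm] at hv
    exact hs hv
  have key (v : F) (hv : v ≠ 0) :
      27 * ((1 + v) ^ 2 / (3 * v)) * (1 - (1 + v) ^ 2 / (3 * v)) ^ 2 = (1 + v ^ 3) ^ 2 / v ^ 3 := by
    field_simp
    ring
  rw [card_eq_sum_card_fiberwise (f := fun v ↦ (1 + v) ^ 2 / (3 * v))
    (t := {x : F | (27 * x * (1 - x) ^ 2)⁻¹ = s})]
  swap
  · intro v hv
    simp only [coe_filter, mem_univ, true_and, Set.mem_ofPred_eq] at hv ⊢
    rw [key v (hne v hv).1, inv_div, hv]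
  push_cast
  refine sum_congr rfl fun x hx ↦ ?_
  rw [mem_filter_univ] at hx
  rw [show 3 * x * (3 * x - 4) = (2 - 3 * x) ^ 2 - 4 * 1 * 1 by ring,
    ← card_quadratic_eq hφ h2 one_ne_zero, filter_filter]
  congr 2
  ext v
  simp only [mem_filter_univ]
  constructor
  · rintro ⟨hv, h⟩
    have := (hne v hv).1
    rw [div_eq_iff (by positivity)] at h
    linear_combination h
  · intro h
    have hv : v ≠ 0 := by
      rintro rfl
      simp at h
    have h' : (1 + v) ^ 2 / (3 * v) = x := by
      rw [div_eq_iff (by positivity)]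
      linear_combination h
    refine ⟨?_, h'⟩
    rw [← inv_div, ← key v hv, h', hx]

theorem card_roots_le_one {φ ω : MulChar F ℂ} (hφ : orderOf φ = 2) (hω : orderOf ω = 3)
    (h3 : (3 : F) ≠ 0) {s : F} (hs : s ≠ 0) (h : φ (1 - 4 * s) = -1) :
    #{x : F | (27 * x * (1 - x) ^ 2)⁻¹ = s} ≤ 1 := by
  have h4 : 1 - 4 * s ≠ 0 := by
    intro h'
    rw [h', MulChar.map_zero] at h
    norm_num at h
  obtain ⟨ζ, hζ⟩ := exists_cube_root_of_unity hω
  rw [card_le_one]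
  intro x hx y hy
  rw [mem_filter_univ] at hx hy
  by_contra hxy
  have h1 := apply_discriminant hφ h3 hs h4 hx
  have e : x * (1 - x) ^ 2 - y * (1 - y) ^ 2 = 0 := by
    have ex := root_eq hs hx
    have ey := root_eq hs hy
    have : 27 * s ≠ 0 := by
      have h27 : (27 : F) = 3 ^ 3 := by norm_num
      rw [h27]
      positivity
    apply mul_left_cancel₀ this
    linear_combination ex - ey
  have e2 : x ^ 2 + x * y + y ^ 2 - 2 * (x + y) + 1 = 0 := by
    apply mul_left_cancel₀ (sub_ne_zero.mpr hxy)
    linear_combination e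
  have e3 : 3 * x * (3 * x - 4) = ((2 * ζ + 1) * (2 * y + x - 2)) ^ 2 := by
    linear_combination 12 * e2 - 4 * (2 * y + x - 2) ^ 2 * hζ
  rw [h, e3] at h1
  rcases eq_or_ne ((2 * ζ + 1) * (2 * y + x - 2)) 0 with h0 | h0
  · rw [h0] at h1
    norm_num [MulChar.map_zero] at h1
  · rw [MulChar.apply_sq_of_orderOf_eq_two hφ h0] at h1
    norm_num at h1

theorem exists_sum_fiber_eq_card_roots {φ ω : MulChar F ℂ} (hφ : orderOf φ = 2)
    (hω : orderOf ω = 3) (h2 : (2 : F) ≠ 0) (h3 : (3 : F) ≠ 0) {s : F} (hs : s ≠ 0) :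
    ∃ k : ℕ, ∑ u : F with u / (1 + u) ^ 2 = s, ω u =
      (#{x : F | (27 * x * (1 - x) ^ 2)⁻¹ = s} : ℂ) - 1 + k := by
  by_cases h4 : 1 - 4 * s = 0
  · refine ⟨0, ?_⟩
    have h4' : (4 : F) = 2 ^ 2 := by norm_num
    have hU : ({u : F | u / (1 + u) ^ 2 = s} : Finset F) = {1} := by
      ext u
      simp only [mem_filter_univ, mem_singleton]
      constructor
      · intro hu
        have := (fiber_ne hs hu).2
        rw [div_eq_iff (by positivity)] at hu
        have : (u - 1) ^ 2 = 0 := by linear_combination -4 * hu + h4 * (1 + u) ^ 2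
        simpa [sub_eq_zero] using this
      · rintro rfl
        have : (1 : F) + 1 ≠ 0 := by rwa [one_add_one_eq_two]
        rw [div_eq_iff (by positivity)]
        linear_combination h4
    have hR : ({x : F | (27 * x * (1 - x) ^ 2)⁻¹ = s} : Finset F) = {1 / 3, 4 / 3} := by
      have hs' : s = 1 / 4 := by
        rw [h4'] at h4 ⊢
        field_simp
        linear_combination -h4
      ext x
      simp only [mem_filter_univ, mem_insert, mem_singleton]
      constructor
      · intro hx
        have := discriminant_eq h3 hs hx
        obtain ⟨h0, h1⟩ := root_ne hs hx
        have h9 : (9 : F) = 3 ^ 2 := by norm_num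
        rw [h4, h9, eq_comm] at this
        simp [h0, h1, h3, sub_eq_zero] at this
        rw [eq_div_iff h3, eq_div_iff h3, mul_comm x]
        tauto
      · have h27 : (27 : F) = 3 ^ 3 := by norm_num
        rintro (rfl | rfl)
        · rw [hs', one_div 4, inv_inj, h27]
          field_simp
          norm_num
        · rw [hs', one_div 4, inv_inj, h27]
          field_simp
          norm_num
    rw [hU, hR, sum_singleton, map_one, card_pair]
    · norm_num
    · intro h
      field_simp at h
      apply h3
      linear_combination -h
  have e := sum_card_cubes hω h3 hs
  rw [sum_card_roots hφ h2 h3 hs, card_fiber_eq hφ h2 hs, sum_congr rfl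
    (fun x hx ↦ by rw [apply_discriminant hφ h3 hs h4 (by simpa using hx)]), sum_const,
    nsmul_eq_mul] at e
  have hsq := φ.apply_pow_orderOf_eq_one h4
  rw [hφ] at hsq
  rcases sq_eq_sq_iff_eq_or_eq_neg.mp (hsq.trans (one_pow 2).symm) with h | h
  · refine ⟨0, ?_⟩
    rw [h] at e
    push_cast
    linear_combination -e / 2
  · have := card_roots_le_one hφ hω h3 hs h
    refine ⟨1 - #{x : F | (27 * x * (1 - x) ^ 2)⁻¹ = s}, ?_⟩
    rw [h] at e
    rw [Nat.cast_sub this]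
    push_cast
    linear_combination -e / 2

/-- Cardano's criterion: a depressed cubic has `1 + ω(u) + ω(u⁻¹)` roots when its resolvent
quadratic has the two roots `u` and `u⁻¹`, and just one root when the resolvent is irreducible. -/
theorem sum_fiber_eq_card_roots {φ ω : MulChar F ℂ} (hφ : orderOf φ = 2)
    (hω : orderOf ω = 3) (h2 : (2 : F) ≠ 0) (h3 : (3 : F) ≠ 0) {s : F} (hs : s ≠ 0) :
    ∑ u : F with u / (1 + u) ^ 2 = s, ω u =
      (#{x : F | (27 * x * (1 - x) ^ 2)⁻¹ = s} : ℂ) - 1 := by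
  choose! k hk using fun (s : F) (hs : s ≠ 0) ↦
    exists_sum_fiber_eq_card_roots hφ hω h2 h3 hs
  have h27 : (27 : F) ≠ 0 := by
    rw [show (27 : F) = 3 ^ 3 by norm_num]
    exact pow_ne_zero _ h3
  have hU : ∑ s : F, ∑ u : F with u / (1 + u) ^ 2 = s, ω u = 0 := by
    rw [sum_fiberwise, MulChar.sum_eq_zero_of_ne_one (MulChar.ne_one_of_orderOf hω (by norm_num))]
  have hR : ∑ s : F, (#{x : F | (27 * x * (1 - x) ^ 2)⁻¹ = s} : ℂ) = Fintype.card F := by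
    rw [← Nat.cast_sum, ← card_eq_sum_card_fiberwise (by simp), card_univ]
  have hU0 : ∑ u : F with u / (1 + u) ^ 2 = 0, ω u = ω (-1) := by
    have : ({u : F | u / (1 + u) ^ 2 = 0} : Finset F) = {0, -1} := by
      ext u
      simp [eq_neg_iff_add_eq_zero, add_comm]
    rw [this, sum_pair (by simp), MulChar.map_zero, zero_add]
  have hR0 : #{x : F | (27 * x * (1 - x) ^ 2)⁻¹ = 0} = 2 := by
    have : ({x : F | (27 * x * (1 - x) ^ 2)⁻¹ = 0} : Finset F) = {0, 1} := by
      ext u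
      simp only [mem_filter_univ, mem_insert, mem_singleton, inv_eq_zero, mul_eq_zero, h27,
        false_or, pow_eq_zero_iff two_ne_zero, sub_eq_zero, eq_comm (a := (1 : F))]
    rw [this, card_pair (by simp)]
  have hω1 : ω (-1) = 1 := MulChar.val_neg_one_eq_one_of_odd_order (n := 3) (by decide)
    (by rw [← hω, pow_orderOf_eq_one])
  rw [← add_sum_erase _ _ (mem_univ 0), hU0, hω1,
    sum_congr rfl (fun s hs ↦ hk s (by simpa using hs)), sum_add_distrib, sum_sub_distrib] at hU
  rw [← add_sum_erase _ _ (mem_univ 0), hR0] at hR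
  have hc : (#((univ : Finset F).erase 0) : ℂ) = Fintype.card F - 1 := by
    rw [card_erase_of_mem (mem_univ _), card_univ, Nat.cast_sub Fintype.card_pos]
    simp
  rw [sum_const, nsmul_eq_mul, hc] at hU
  have h0 : ((∑ s ∈ (univ : Finset F).erase 0, k s : ℕ) : ℂ) = 0 := by
    push_cast at hR ⊢
    linear_combination hU - hR
  rw [Nat.cast_eq_zero, sum_eq_zero_iff] at h0
  rw [hk s hs, h0 s (by simpa using hs)]
  simp

end counting

section gauss

variable {F : Type*} [Field F] [Fintype F]

theorem sum_div_one_add (f : F → ℂ) (h0 : f 0 = 0) (h1 : f 1 = 0) :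
    ∑ y, f y = ∑ u, f (u / (1 + u)) := by
  classical
  rw [← add_sum_erase _ _ (mem_univ 1), h1, zero_add, ← add_sum_erase univ _ (mem_univ (-1)),
    add_neg_cancel, div_zero, h0, zero_add]
  have hu (u : F) (hu : u ∈ univ.erase (-1)) : 1 + u ≠ 0 := by
    simpa [eq_neg_iff_add_eq_zero, add_comm] using hu
  have hy (y : F) (hy : y ∈ univ.erase 1) : 1 - y ≠ 0 :=
    sub_ne_zero.mpr (ne_of_mem_erase hy).symm
  symm
  refine sum_bij' (fun u _ ↦ u / (1 + u)) (fun y _ ↦ y / (1 - y)) ?_ ?_ ?_ ?_ ?_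
  · intro u h
    have := hu u h
    refine mem_erase.mpr ⟨fun h' ↦ ?_, mem_univ _⟩
    rw [div_eq_iff this] at h'
    exact one_ne_zero (α := F) (by linear_combination -h')
  · intro y h
    have := hy y h
    refine mem_erase.mpr ⟨fun h' ↦ ?_, mem_univ _⟩
    rw [div_eq_iff this] at h'
    exact one_ne_zero (α := F) (by linear_combination h')
  · intro u h
    have := hu u h
    have : 1 - u / (1 + u) = 1 / (1 + u) := by field_simp; ring
    rw [this]
    field_simp
  · intro y h
    have := hy y h
    have : 1 + y / (1 - y) = 1 / (1 - y) := by field_simp; ring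
    rw [this]
    field_simp
  · simp

theorem jacobiSum_mul_inv_mul (ω θ : MulChar F ℂ) :
    jacobiSum (ω * θ) (ω⁻¹ * θ) = ∑ u, ω u * θ (u / (1 + u) ^ 2) := by
  rw [jacobiSum, sum_div_one_add _ (by simp [MulChar.map_zero]) (by simp [MulChar.map_zero])]
  refine sum_congr rfl fun u _ ↦ ?_
  rcases eq_or_ne (1 + u) 0 with h | h
  · simp [h, MulChar.map_zero]
  rw [show 1 - u / (1 + u) = (1 + u)⁻¹ by field_simp; ring]
  simp only [MulChar.mul_apply, MulChar.inv_apply']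
  rw [mul_mul_mul_comm, ← map_mul, ← map_mul]
  congr 2 <;> field_simp

theorem jacobiSum_sq_mul_inv_sq {φ : MulChar F ℂ} (hφ : φ⁻¹ = φ) (θ : MulChar F ℂ) :
    jacobiSum (θ * θ) (φ * (θ * θ)⁻¹) = ∑ v, θ (v ^ 2) * φ (1 + v) := by
  rw [jacobiSum, sum_div_one_add _ (by simp [MulChar.map_zero]) (by simp [MulChar.map_zero])]
  refine sum_congr rfl fun u _ ↦ ?_
  rcases eq_or_ne (1 + u) 0 with h | h
  · simp [h, MulChar.map_zero]
  rw [show 1 - u / (1 + u) = (1 + u)⁻¹ by field_simp; ring]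
  nth_rw 1 [← hφ]
  simp only [MulChar.mul_apply, MulChar.inv_apply', mul_inv_rev, inv_inv]
  rw [mul_left_comm, mul_comm (φ _)]
  simp only [← map_mul]
  congr 2
  field_simp

theorem jacobiSum_inv_inv_sq (θ : MulChar F ℂ) :
    jacobiSum θ⁻¹ (θ⁻¹ * θ⁻¹) = ∑ x, θ (x * (1 - x) ^ 2)⁻¹ := by
  refine sum_congr rfl fun x _ ↦ ?_
  simp only [MulChar.mul_apply, MulChar.inv_apply', ← map_mul]
  rw [mul_inv, sq, mul_inv]

theorem jacobiSum_self [DecidableEq F] {φ : MulChar F ℂ} (hφ : orderOf φ = 2) (h2 : (2 : F) ≠ 0)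
    {χ : MulChar F ℂ} (hχ : χ ≠ 1) : jacobiSum χ χ = χ⁻¹ 4 * jacobiSum χ φ := by
  have h4 : (4 : F) ≠ 0 := by
    rw [show (4 : F) = 2 ^ 2 by norm_num]
    exact pow_ne_zero _ h2
  have h1 : jacobiSum χ χ = ∑ s, χ s * (1 + φ (1 - 4 * s)) := by
    simp only [jacobiSum, ← map_mul]
    rw [← sum_fiberwise univ (fun x ↦ x * (1 - x))]
    refine sum_congr rfl fun s _ ↦ ?_
    rw [sum_congr rfl (g := fun _ ↦ χ s) (fun x hx ↦ by rw [(mem_filter.mp hx).2]), sum_const,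
      nsmul_eq_mul, mul_comm, show 1 - 4 * s = (-1) ^ 2 - 4 * 1 * s by ring,
      ← card_quadratic_eq hφ h2 one_ne_zero]
    congr 3
    ext x
    simp only [mem_filter_univ]
    grind
  simp only [mul_add, mul_one, sum_add_distrib, MulChar.sum_eq_zero_of_ne_one hχ, zero_add] at h1
  have hs := Fintype.sum_bijective _ (mulLeft_bijective₀ (4 : F) h4)
    (fun s ↦ χ (4 * s) * φ (1 - 4 * s)) (fun s ↦ χ s * φ (1 - s)) fun _ ↦ rfl
  rw [h1, jacobiSum, ← hs, mul_sum, MulChar.inv_apply']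
  refine sum_congr rfl fun s _ ↦ ?_
  rw [← mul_assoc, ← map_mul, inv_mul_cancel_left₀ h4]

theorem jacobiSum_cubic [DecidableEq F] {φ ω : MulChar F ℂ} (hφ : orderOf φ = 2)
    (hω : orderOf ω = 3) (h2 : (2 : F) ≠ 0) (h3 : (3 : F) ≠ 0) (θ : MulChar F ℂ) :
    jacobiSum (ω * θ) (ω⁻¹ * θ) = θ⁻¹ 27 * jacobiSum θ⁻¹ (θ⁻¹ * θ⁻¹) - ∑ s, θ s := by
  have h1 : jacobiSum (ω * θ) (ω⁻¹ * θ) =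
      ∑ s, θ s * ∑ u : F with u / (1 + u) ^ 2 = s, ω u := by
    rw [jacobiSum_mul_inv_mul, ← sum_fiberwise univ (fun u ↦ u / (1 + u) ^ 2)]
    refine sum_congr rfl fun s _ ↦ ?_
    rw [mul_sum]
    refine sum_congr rfl fun u hu ↦ ?_
    rw [(mem_filter.mp hu).2, mul_comm]
  have h4 : θ⁻¹ 27 * jacobiSum θ⁻¹ (θ⁻¹ * θ⁻¹) =
      ∑ s, θ s * #{x : F | (27 * x * (1 - x) ^ 2)⁻¹ = s} := by
    rw [jacobiSum_inv_inv_sq, mul_sum, ← sum_fiberwise univ (fun x ↦ (27 * x * (1 - x) ^ 2)⁻¹)]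
    refine sum_congr rfl fun s _ ↦ ?_
    rw [sum_congr rfl (g := fun _ ↦ θ s), sum_const, nsmul_eq_mul, mul_comm]
    intro x hx
    rw [← (mem_filter.mp hx).2, MulChar.inv_apply', ← map_mul, ← mul_inv, mul_assoc 27]
  rw [h1, h4, ← sum_sub_distrib]
  refine sum_congr rfl fun s _ ↦ ?_
  rcases eq_or_ne s 0 with rfl | hs
  · simp [MulChar.map_zero]
  · rw [sum_fiber_eq_card_roots hφ hω h2 h3 hs]
    ring

theorem gaussSum_mul_gaussSum_inv {χ : MulChar F ℂ} (hχ : χ ≠ 1) {ψ : AddChar F ℂ}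
    (hψ : ψ.IsPrimitive) : gaussSum χ ψ * gaussSum χ⁻¹ ψ = χ (-1) * Fintype.card F := by
  rw [← mul_gaussSum_inv_eq_gaussSum χ⁻¹, mul_left_comm, gaussSum_mul_gaussSum_eq_card hχ hψ,
    MulChar.inv_apply', inv_neg_one]

/-- The Hasse–Davenport duplication formula. -/
theorem gaussSum_duplication [DecidableEq F] {φ : MulChar F ℂ} (hφ : orderOf φ = 2)
    (h2 : (2 : F) ≠ 0) (χ : MulChar F ℂ) {ψ : AddChar F ℂ} (hψ : ψ.IsPrimitive) :
    gaussSum χ ψ * gaussSum (χ * φ) ψ = χ⁻¹ 4 * gaussSum (χ * χ) ψ * gaussSum φ ψ := by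
  have hφ1 : φ ≠ 1 := MulChar.ne_one_of_orderOf hφ (by norm_num)
  have hφφ : φ * φ = 1 := by rw [← sq, ← hφ, pow_orderOf_eq_one]
  have hφ4 : φ 4 = 1 := by
    rw [show (4 : F) = 2 ^ 2 by norm_num, MulChar.apply_sq_of_orderOf_eq_two hφ h2]
  have h4 : IsUnit (4 : F) := by
    rw [show (4 : F) = 2 ^ 2 by norm_num, isUnit_iff_ne_zero]
    exact pow_ne_zero _ h2
  have hq : (Fintype.card F : ℂ) ≠ 0 := Nat.cast_ne_zero.mpr Fintype.card_ne_zero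
  rcases eq_or_ne χ 1 with rfl | h1
  · simp [MulChar.one_apply h4]
  rcases eq_or_ne χ φ with rfl | h2'
  · rw [hφφ, MulChar.inv_apply_eq_inv', hφ4]
    ring
  have hχφ : χ * φ ≠ 1 := by
    intro h
    apply h2'
    rw [eq_inv_of_mul_eq_one_left h, ← eq_inv_of_mul_eq_one_left hφφ]
  have hJ := jacobiSum_mul_nontrivial hχφ ψ
  by_cases h3 : χ * χ = 1
  · have hχ : orderOf χ = 2 := orderOf_eq_prime (by rw [sq, h3]) h1
    refine absurd (DFunLike.ext _ _ fun s ↦ ?_) h2'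
    have h := card_sq_eq hχ h2 s
    rw [card_sq_eq hφ h2 s] at h
    exact (add_left_cancel h).symm
  have hJ2 := jacobiSum_mul_nontrivial h3 ψ
  rw [jacobiSum_self hφ h2 h1] at hJ2
  have hg := gaussSum_ne_zero_of_nontrivial hq h1 hψ
  apply mul_left_cancel₀ hg
  linear_combination -gaussSum (χ * φ) ψ * hJ2 + χ⁻¹ 4 * gaussSum (χ * χ) ψ * hJ

end gauss

section product

theorem MulChar.apply_neg_one_mul_self {F : Type*} [Field F] (χ : MulChar F ℂ) :
    χ (-1) * χ (-1) = 1 := by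
  rw [← map_mul]
  simp

theorem orderOf_pow_six {G : Type*} [Group G] {ξ : G} (hξ : orderOf ξ = 12) :
    orderOf (ξ ^ 6) = 2 := by
  rw [orderOf_pow_of_dvd (by norm_num) (by rw [hξ]; norm_num), hξ]

theorem orderOf_pow_four {G : Type*} [Group G] {ξ : G} (hξ : orderOf ξ = 12) :
    orderOf (ξ ^ 4) = 3 := by
  rw [orderOf_pow_of_dvd (by norm_num) (by rw [hξ]; norm_num), hξ]

variable {F : Type*} [Field F] {ξ : MulChar F ℂ} (hξ : orderOf ξ = 12)

theorem pow_six_apply_neg_one : (ξ ^ 6) (-1) = 1 := by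
  rw [MulChar.pow_apply' _ (by norm_num)]
  linear_combination ((ξ (-1)) ^ 4 + (ξ (-1)) ^ 2 + 1) * ξ.apply_neg_one_mul_self

theorem pow_four_apply_neg_one : (ξ ^ 4) (-1) = 1 := by
  rw [MulChar.pow_apply' _ (by norm_num)]
  linear_combination ((ξ (-1)) ^ 2 + 1) * ξ.apply_neg_one_mul_self

variable [Fintype F]

include hξ

theorem pow_six_apply_four (h2 : (2 : F) ≠ 0) : (ξ ^ 6) 4 = 1 := by
  rw [show (4 : F) = 2 ^ 2 by norm_num,
    MulChar.apply_sq_of_orderOf_eq_two (orderOf_pow_six hξ) h2]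

theorem pow_three_inv_mul_inv_apply_four (h2 : (2 : F) ≠ 0) (θ : MulChar F ℂ) :
    (ξ ^ 3 * θ⁻¹)⁻¹ 4 = (ξ ^ 3) 4 * θ 4 := by
  rw [mul_inv_rev, inv_inv, MulChar.mul_apply, mul_comm, MulChar.inv_apply_eq_inv']
  have h : (ξ ^ 3) 4 * (ξ ^ 3) 4 = 1 := by
    rw [← MulChar.mul_apply, ← pow_add, pow_six_apply_four hξ h2]
  rw [← eq_inv_of_mul_eq_one_left h]

variable [DecidableEq F]

theorem pow_six_apply_neg_three (h3 : (3 : F) ≠ 0) : (ξ ^ 6) (-3) = 1 := by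
  obtain ⟨ζ, hζ⟩ := exists_cube_root_of_unity (orderOf_pow_four hξ)
  have h : (-3 : F) = (2 * ζ + 1) ^ 2 := by linear_combination -4 * hζ
  rw [h, MulChar.apply_sq_of_orderOf_eq_two (orderOf_pow_six hξ)]
  intro h'
  apply h3
  rw [h'] at h
  linear_combination -h

theorem pow_six_apply_twenty_seven (h3 : (3 : F) ≠ 0) : (ξ ^ 6) 27 = 1 := by
  rw [show (27 : F) = -1 * ((-3) * (-3) ^ 2) by norm_num, map_mul, map_mul, map_pow,
    pow_six_apply_neg_one, pow_six_apply_neg_three hξ h3]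
  norm_num

theorem jacobiSum_mul_jacobiSum_mul_card (h2 : (2 : F) ≠ 0) (θ : MulChar F ℂ) {ψ : AddChar F ℂ}
    (hψ : ψ.IsPrimitive) :
    jacobiSum (ξ ^ 4 * θ) (ξ ^ 9 * θ⁻¹) * jacobiSum (ξ ^ 8 * θ) (ξ ^ 3 * θ⁻¹) *
        (ξ (-1) * Fintype.card F) =
      (ξ ^ 3) 4 * θ 4 * (gaussSum (ξ ^ 4 * θ) ψ * gaussSum (ξ ^ 8 * θ) ψ) *
        (gaussSum (ξ ^ 6 * (θ * θ)⁻¹) ψ * gaussSum (ξ ^ 6) ψ) := by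
  have h12 : ξ ^ 12 = 1 := by rw [← hξ, pow_orderOf_eq_one]
  have hξ1 : ξ ≠ 1 := MulChar.ne_one_of_orderOf hξ (by norm_num)
  have e1 : ξ ^ 4 * θ * (ξ ^ 9 * θ⁻¹) = ξ := by
    rw [mul_mul_mul_comm, mul_inv_cancel, mul_one, ← pow_add, pow_succ ξ 12, h12, one_mul]
  have e2 : ξ ^ 8 * θ * (ξ ^ 3 * θ⁻¹) = ξ⁻¹ := by
    rw [mul_mul_mul_comm, mul_inv_cancel, mul_one, ← pow_add]
    exact eq_inv_of_mul_eq_one_left (by rw [← pow_succ, h12])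
  have e3 : ξ ^ 3 * θ⁻¹ * ξ ^ 6 = ξ ^ 9 * θ⁻¹ := by
    rw [mul_right_comm, ← pow_add]
  have e4 : ξ ^ 3 * θ⁻¹ * (ξ ^ 3 * θ⁻¹) = ξ ^ 6 * (θ * θ)⁻¹ := by
    rw [mul_mul_mul_comm, ← pow_add, mul_inv]
  have j1 := jacobiSum_mul_nontrivial (e1 ▸ hξ1) ψ
  have j2 := jacobiSum_mul_nontrivial (e2 ▸ inv_ne_one.mpr hξ1) ψ
  have d := gaussSum_duplication (orderOf_pow_six hξ) h2 (ξ ^ 3 * θ⁻¹) hψ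
  rw [e1] at j1
  rw [e2] at j2
  rw [e3, e4, pow_three_inv_mul_inv_apply_four hξ h2] at d
  rw [← gaussSum_mul_gaussSum_inv hξ1 hψ]
  linear_combination gaussSum ξ⁻¹ ψ * jacobiSum (ξ ^ 8 * θ) (ξ ^ 3 * θ⁻¹) * j1 +
    gaussSum (ξ ^ 4 * θ) ψ * gaussSum (ξ ^ 9 * θ⁻¹) ψ * j2 +
    gaussSum (ξ ^ 4 * θ) ψ * gaussSum (ξ ^ 8 * θ) ψ * d

theorem jacobiSum_mul_jacobiSum_of_mul_self_ne_one (h2 : (2 : F) ≠ 0) (h3 : (3 : F) ≠ 0)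
    {θ : MulChar F ℂ} (hθ : θ * θ ≠ 1) :
    jacobiSum (ξ ^ 4 * θ) (ξ ^ 9 * θ⁻¹) * jacobiSum (ξ ^ 8 * θ) (ξ ^ 3 * θ⁻¹) =
      ξ (-1) * (ξ ^ 3) 4 * θ 4 * (θ⁻¹ 27 * jacobiSum θ⁻¹ (θ⁻¹ * θ⁻¹) *
        jacobiSum (θ * θ) (ξ ^ 6 * (θ * θ)⁻¹)) := by
  have hψ := AddChar.FiniteField.primitiveChar_to_Complex_isPrimitive F
  set ψ := AddChar.FiniteField.primitiveChar_to_Complex F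
  have hq : (Fintype.card F : ℂ) ≠ 0 := Nat.cast_ne_zero.mpr Fintype.card_ne_zero
  have h12 : ξ ^ 12 = 1 := by rw [← hξ, pow_orderOf_eq_one]
  have hφ1 : ξ ^ 6 ≠ 1 := MulChar.ne_one_of_orderOf (orderOf_pow_six hξ) (by norm_num)
  have hθ1 : θ ≠ 1 := by
    rintro rfl
    simp at hθ
  have e0 : (ξ ^ 4)⁻¹ = ξ ^ 8 := inv_eq_of_mul_eq_one_right (by rw [← pow_add, h12])
  have e1 : ξ ^ 4 * θ * (ξ ^ 8 * θ) = θ * θ := by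
    rw [mul_mul_mul_comm, ← pow_add, h12, one_mul]
  have e2 : θ * θ * (ξ ^ 6 * (θ * θ)⁻¹) = ξ ^ 6 := by
    rw [mul_left_comm, mul_inv_cancel, mul_one]
  have b := jacobiSum_mul_jacobiSum_mul_card hξ h2 θ hψ
  have c := jacobiSum_cubic (orderOf_pow_six hξ) (orderOf_pow_four hξ) h2 h3 θ
  rw [e0, MulChar.sum_eq_zero_of_ne_one hθ1, sub_zero] at c
  have j1 := jacobiSum_mul_nontrivial (e1 ▸ hθ) ψ
  have j2 := jacobiSum_mul_nontrivial (e2 ▸ hφ1) ψ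
  rw [e1, c] at j1
  rw [e2] at j2
  have g := gaussSum_mul_gaussSum_inv hφ1 hψ
  rw [← eq_inv_of_mul_eq_one_left (a := ξ ^ 6) (by rw [← pow_add, h12]), pow_six_apply_neg_one,
    one_mul] at g
  have s := ξ.apply_neg_one_mul_self
  apply mul_right_cancel₀ hq
  linear_combination ξ (-1) * b - Fintype.card F *
      (jacobiSum (ξ ^ 4 * θ) (ξ ^ 9 * θ⁻¹) * jacobiSum (ξ ^ 8 * θ) (ξ ^ 3 * θ⁻¹)) * s +
    ξ (-1) * (ξ ^ 3) 4 * θ 4 *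
      (-gaussSum (ξ ^ 6 * (θ * θ)⁻¹) ψ * gaussSum (ξ ^ 6) ψ * j1 +
        θ⁻¹ 27 * jacobiSum θ⁻¹ (θ⁻¹ * θ⁻¹) *
          (jacobiSum (θ * θ) (ξ ^ 6 * (θ * θ)⁻¹) * g - gaussSum (ξ ^ 6) ψ * j2))

theorem jacobiSum_mul_jacobiSum_of_mul_self_eq_one (h2 : (2 : F) ≠ 0) {θ : MulChar F ℂ}
    (hθ : θ * θ = 1) :
    jacobiSum (ξ ^ 4 * θ) (ξ ^ 9 * θ⁻¹) * jacobiSum (ξ ^ 8 * θ) (ξ ^ 3 * θ⁻¹) =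
      ξ (-1) * (ξ ^ 3) 4 * θ 4 * (θ (-1) * Fintype.card F) := by
  have hψ := AddChar.FiniteField.primitiveChar_to_Complex_isPrimitive F
  set ψ := AddChar.FiniteField.primitiveChar_to_Complex F
  have hq : (Fintype.card F : ℂ) ≠ 0 := Nat.cast_ne_zero.mpr Fintype.card_ne_zero
  have h12 : ξ ^ 12 = 1 := by rw [← hξ, pow_orderOf_eq_one]
  have hφ1 : ξ ^ 6 ≠ 1 := MulChar.ne_one_of_orderOf (orderOf_pow_six hξ) (by norm_num)
  have e1 : ξ ^ 8 * θ = (ξ ^ 4 * θ)⁻¹ := by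
    apply eq_inv_of_mul_eq_one_left
    rw [mul_mul_mul_comm, ← pow_add, h12, hθ, one_mul]
  have h1 : ξ ^ 4 * θ ≠ 1 := by
    intro h
    have h4 : (ξ ^ 4) ^ 3 = 1 := by rw [← pow_mul, h12]
    have h5 := MulChar.ne_one_of_orderOf (orderOf_pow_four hξ) (by norm_num)
    have h6 : (ξ ^ 4 * θ) ^ 2 = 1 := by rw [h, one_pow]
    rw [mul_pow, sq θ, hθ, mul_one] at h6
    rw [pow_succ, h6, one_mul] at h4
    exact h5 h4
  have b := jacobiSum_mul_jacobiSum_mul_card hξ h2 θ hψ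
  have g1 := gaussSum_mul_gaussSum_inv h1 hψ
  rw [MulChar.mul_apply, pow_four_apply_neg_one, one_mul, ← e1] at g1
  have g := gaussSum_mul_gaussSum_inv hφ1 hψ
  rw [← eq_inv_of_mul_eq_one_left (a := ξ ^ 6) (by rw [← pow_add, h12]), pow_six_apply_neg_one,
    one_mul] at g
  rw [hθ, inv_one, mul_one, g, g1] at b
  have s := ξ.apply_neg_one_mul_self
  apply mul_right_cancel₀ hq
  linear_combination ξ (-1) * b - (Fintype.card F * 
    (jacobiSum (ξ ^ 4 * θ) (ξ ^ 9 * θ⁻¹) * jacobiSum (ξ ^ 8 * θ) (ξ ^ 3 * θ⁻¹))) * s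

theorem jacobiSum_mul_jacobiSum [DecidableEq (MulChar F ℂ)] (h2 : (2 : F) ≠ 0) (h3 : (3 : F) ≠ 0)
    (θ : MulChar F ℂ) :
    jacobiSum (ξ ^ 4 * θ) (ξ ^ 9 * θ⁻¹) * jacobiSum (ξ ^ 8 * θ) (ξ ^ 3 * θ⁻¹) =
      ξ (-1) * (ξ ^ 3) 4 * θ 4 * (θ⁻¹ 27 * jacobiSum θ⁻¹ (θ⁻¹ * θ⁻¹) *
          jacobiSum (θ * θ) (ξ ^ 6 * (θ * θ)⁻¹) +
        (if θ = 1 then 2 * ((Fintype.card F : ℂ) - 1) else 0) +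
        (if θ = ξ ^ 6 then (Fintype.card F : ℂ) - 1 else 0)) := by
  have hφ1 : ξ ^ 6 ≠ 1 := MulChar.ne_one_of_orderOf (orderOf_pow_six hξ) (by norm_num)
  have h27 : IsUnit (27 : F) := by
    rw [show (27 : F) = 3 ^ 3 by norm_num, isUnit_iff_ne_zero]
    exact pow_ne_zero _ h3
  by_cases hθ : θ * θ = 1
  · rw [jacobiSum_mul_jacobiSum_of_mul_self_eq_one hξ h2 hθ, hθ, inv_one, mul_one,
      ← eq_inv_of_mul_eq_one_left hθ, hθ, jacobiSum_one_nontrivial hφ1]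
    rcases eq_or_ne θ 1 with rfl | h1
    · rw [jacobiSum_one_one, if_pos rfl, if_neg hφ1.symm, MulChar.one_apply h27,
        MulChar.one_apply isUnit_one.neg]
      ring
    · have hθ6 : θ = ξ ^ 6 := by
        have h : orderOf θ = 2 := orderOf_eq_prime (by rw [sq, hθ]) h1
        refine DFunLike.ext _ _ fun s ↦ ?_
        have h := card_sq_eq h h2 s
        rw [card_sq_eq (orderOf_pow_six hξ) h2 s] at h
        exact (add_left_cancel h).symm
      rw [jacobiSum_comm, jacobiSum_one_nontrivial h1, if_neg h1, if_pos hθ6, hθ6,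
        pow_six_apply_neg_one, pow_six_apply_twenty_seven hξ h3]
      ring
  · have h1 : θ ≠ 1 := by
      rintro rfl
      simp at hθ
    have h6 : θ ≠ ξ ^ 6 := by
      rintro rfl
      exact hθ (by rw [← pow_add, ← pow_orderOf_eq_one ξ, hξ])
    rw [jacobiSum_mul_jacobiSum_of_mul_self_ne_one hξ h2 h3 hθ, if_neg h1, if_neg h6, add_zero,
      add_zero]

end product

section curve

variable {F : Type*} [Field F] [Fintype F]

theorem card_mulChar_complex : Nat.card (MulChar F ℂ) = Fintype.card F - 1 := by
  classical
  rw [MulChar.card_eq_card_units_of_hasEnoughRootsOfUnity, Nat.card_eq_fintype_card,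
    Fintype.card_units]

theorem cast_card_mulChar_complex [Fintype (MulChar F ℂ)] :
    (Fintype.card (MulChar F ℂ) : ℂ) = Fintype.card F - 1 := by
  rw [← Nat.card_eq_fintype_card, card_mulChar_complex, Nat.cast_sub Fintype.card_pos,
    Nat.cast_one]

theorem sum_mulChar_apply [DecidableEq F] [Fintype (MulChar F ℂ)] (u : F) :
    ∑ χ : MulChar F ℂ, χ u = if u = 1 then (Fintype.card F : ℂ) - 1 else 0 := by
  split_ifs with h
  · simp [h, cast_card_mulChar_complex]
  obtain ⟨η, hη⟩ := MulChar.exists_apply_ne_one_of_hasEnoughRootsOfUnity F ℂ h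
  have key : η u * ∑ χ : MulChar F ℂ, χ u = ∑ χ : MulChar F ℂ, χ u := by
    rw [mul_sum]
    exact Fintype.sum_equiv (Equiv.mulLeft η) _ _ fun χ ↦ (MulChar.mul_apply η χ u).symm
  have : (η u - 1) * ∑ χ : MulChar F ℂ, χ u = 0 := by linear_combination key
  exact (mul_eq_zero.mp this).resolve_left (sub_ne_zero.mpr hη)

theorem sum_jacobiSum_mul_jacobiSum [DecidableEq F] [Fintype (MulChar F ℂ)] {φ : MulChar F ℂ}
    (hφ : φ⁻¹ = φ) (c : F) :
    ∑ θ : MulChar F ℂ, θ c * (θ⁻¹ 27 * jacobiSum θ⁻¹ (θ⁻¹ * θ⁻¹) *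
        jacobiSum (θ * θ) (φ * (θ * θ)⁻¹)) =
      ((Fintype.card F : ℂ) - 1) *
        ∑ P : F × F with c * P.2 ^ 2 * (27 * P.1 * (1 - P.1) ^ 2)⁻¹ = 1, φ (1 + P.2) := by
  have key (θ : MulChar F ℂ) : θ c * (θ⁻¹ 27 * jacobiSum θ⁻¹ (θ⁻¹ * θ⁻¹) *
      jacobiSum (θ * θ) (φ * (θ * θ)⁻¹)) =
      ∑ P : F × F, φ (1 + P.2) * θ (c * P.2 ^ 2 * (27 * P.1 * (1 - P.1) ^ 2)⁻¹) := by
    rw [jacobiSum_inv_inv_sq, jacobiSum_sq_mul_inv_sq hφ, Fintype.sum_prod_type, mul_assoc,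
      sum_mul_sum, mul_sum, mul_sum]
    refine sum_congr rfl fun x _ ↦ ?_
    rw [mul_sum, mul_sum]
    refine sum_congr rfl fun v _ ↦ ?_
    rw [mul_assoc 27, mul_inv 27, map_mul, map_mul, map_mul, MulChar.inv_apply']
    ring_nf
  simp only [key]
  rw [sum_comm]
  simp only [← mul_sum, sum_mulChar_apply]
  rw [sum_filter, mul_sum]
  refine sum_congr rfl fun P _ ↦ ?_
  split_ifs <;> ring

theorem sum_resolvent_eq [DecidableEq F] {φ : MulChar F ℂ} (hφ : orderOf φ = 2)
    (h3 : (3 : F) ≠ 0) {a b : F} (ha : a ≠ 0) (hb : b ≠ 0) :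
    ∑ P : F × F with -27 * b ^ 2 / a ^ 3 * P.2 ^ 2 * (27 * P.1 * (1 - P.1) ^ 2)⁻¹ = 1,
        φ (1 + P.2) =
      φ b * ∑ X : F with X ≠ 0 ∧ X ^ 2 + a ≠ 0, φ (X ^ 3 + a * X + b) := by
  have h27 : (27 : F) ≠ 0 := by
    rw [show (27 : F) = 3 ^ 3 by norm_num]
    exact pow_ne_zero _ h3
  have key (x v : F) (h : -27 * b ^ 2 / a ^ 3 * v ^ 2 * (27 * x * (1 - x) ^ 2)⁻¹ = 1) :
      x ≠ 0 ∧ 1 - x ≠ 0 ∧ v ≠ 0 ∧ b ^ 2 * v ^ 2 = -(a ^ 3 * x * (1 - x) ^ 2) := by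
    have hx : x ≠ 0 := by
      rintro rfl
      simp at h
    have h1 : 1 - x ≠ 0 := by
      intro h'
      simp [h'] at h
    have hv : v ≠ 0 := by
      rintro rfl
      simp at h
    refine ⟨hx, h1, hv, ?_⟩
    field_simp at h
    linear_combination -h
  rw [mul_sum]
  refine sum_bij' (fun P _ ↦ b * P.2 / (a * (1 - P.1)))
    (fun X _ ↦ (-X ^ 2 / a, X * (X ^ 2 + a) / b)) ?_ ?_ ?_ ?_ ?_
  · rintro ⟨x, v⟩ h
    obtain ⟨hx, h1, hv, e⟩ := key x v (by simpa using h)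
    rw [mem_filter_univ]
    have : (b * v / (a * (1 - x))) ^ 2 + a = a * (1 - x) := by
      field_simp
      linear_combination e
    rw [this]
    exact ⟨div_ne_zero (mul_ne_zero hb hv) (mul_ne_zero ha h1), mul_ne_zero ha h1⟩
  · intro X h
    obtain ⟨hX, h⟩ := (mem_filter_univ _).mp h
    rw [mem_filter_univ]
    have : 1 - -X ^ 2 / a = (X ^ 2 + a) / a := by
      field_simp
      ring
    simp only [this]
    field_simp
  · rintro ⟨x, v⟩ h
    obtain ⟨hx, h1, hv, e⟩ := key x v (by simpa using h)
    have h' : (b * v / (a * (1 - x))) ^ 2 = -(a * x) := by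
      field_simp
      linear_combination e
    simp only [h', Prod.mk.injEq]
    constructor
    · field_simp
    · field_simp
      ring
  · intro X h
    obtain ⟨hX, h⟩ := (mem_filter_univ _).mp h
    have : 1 - -X ^ 2 / a = (X ^ 2 + a) / a := by
      field_simp
      ring
    simp only [this]
    field_simp
  · rintro ⟨x, v⟩ h
    obtain ⟨hx, h1, hv, e⟩ := key x v (by simpa using h)
    have h' : (b * v / (a * (1 - x))) ^ 2 = -(a * x) := by
      field_simp
      linear_combination e
    have : (b * v / (a * (1 - x))) ^ 3 + a * (b * v / (a * (1 - x))) + b = b * (1 + v) := by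
      rw [pow_succ, h']
      field_simp
      ring
    rw [this, map_mul, ← mul_assoc, ← map_mul, ← sq,
      MulChar.apply_sq_of_orderOf_eq_two hφ hb, one_mul]

theorem sum_apply_cubic_eq [DecidableEq F] {φ : MulChar F ℂ} (hφ : orderOf φ = 2)
    (h2 : (2 : F) ≠ 0) {a : F} (ha : a ≠ 0) (b : F) :
    ∑ X, φ (X ^ 3 + a * X + b) =
      ∑ X : F with X ≠ 0 ∧ X ^ 2 + a ≠ 0, φ (X ^ 3 + a * X + b) + φ b * (2 + φ (-a)) := by
  rw [← sum_filter_add_sum_filter_not univ (fun X : F ↦ X ≠ 0 ∧ X ^ 2 + a ≠ 0)]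
  congr 1
  have h (X : F) (hX : X ∈ ({X : F | ¬(X ≠ 0 ∧ X ^ 2 + a ≠ 0)} : Finset F)) :
      φ (X ^ 3 + a * X + b) = φ b := by
    rw [mem_filter_univ, not_and_or, not_not, not_not] at hX
    congr 1
    rcases hX with h | h
    · rw [h]; ring
    · linear_combination X * h
  have hs : ({X : F | ¬(X ≠ 0 ∧ X ^ 2 + a ≠ 0)} : Finset F) =
      insert 0 ({X : F | X ^ 2 = -a} : Finset F) := by
    ext X
    simp only [mem_filter_univ, not_and_or, not_not, mem_insert, eq_neg_iff_add_eq_zero]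
  rw [sum_congr rfl h, sum_const, nsmul_eq_mul, hs, card_insert_of_notMem (by simpa using ha)]
  push_cast
  rw [card_sq_eq hφ h2]
  ring

theorem sum_bracket_eq [DecidableEq F] [Fintype (MulChar F ℂ)] [DecidableEq (MulChar F ℂ)]
    {ξ : MulChar F ℂ} (hξ : orderOf ξ = 12)
    (h2 : (2 : F) ≠ 0) (h3 : (3 : F) ≠ 0) {a b : F} (ha : a ≠ 0) (hb : b ≠ 0) :
    ∑ θ : MulChar F ℂ, θ (-27 * b ^ 2 / a ^ 3) * (θ⁻¹ 27 * jacobiSum θ⁻¹ (θ⁻¹ * θ⁻¹) *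
          jacobiSum (θ * θ) (ξ ^ 6 * (θ * θ)⁻¹) +
        (if θ = 1 then 2 * ((Fintype.card F : ℂ) - 1) else 0) +
        (if θ = ξ ^ 6 then (Fintype.card F : ℂ) - 1 else 0)) =
      ((Fintype.card F : ℂ) - 1) * ((ξ ^ 6) b * ∑ X, (ξ ^ 6) (X ^ 3 + a * X + b)) := by
  have hφ := orderOf_pow_six hξ
  have hφi : (ξ ^ 6)⁻¹ = ξ ^ 6 :=
    inv_eq_of_mul_eq_one_right (by rw [← pow_add, ← pow_orderOf_eq_one ξ, hξ])
  have hb2 := (ξ ^ 6).apply_pow_orderOf hb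
  have h27 : (27 : F) ≠ 0 := by
    rw [show (27 : F) = 3 ^ 3 by norm_num]
    exact pow_ne_zero _ h3
  have hc : -27 * b ^ 2 / a ^ 3 ≠ 0 :=
    div_ne_zero (mul_ne_zero (neg_ne_zero.mpr h27) (pow_ne_zero _ hb)) (pow_ne_zero _ ha)
  have hφc : (ξ ^ 6) (-27 * b ^ 2 / a ^ 3) = (ξ ^ 6) (-a) := by
    rw [show -27 * b ^ 2 / a ^ 3 = -a * (27 * (b / a ^ 2) ^ 2) by field_simp, map_mul, map_mul,
      pow_six_apply_twenty_seven hξ h3,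
      MulChar.apply_sq_of_orderOf_eq_two hφ (div_ne_zero hb (pow_ne_zero _ ha)), mul_one, mul_one]
  simp only [mul_add, sum_add_distrib, mul_ite, mul_zero, sum_ite_eq', mem_univ, if_true]
  rw [sum_jacobiSum_mul_jacobiSum hφi, sum_resolvent_eq hφ h3 ha hb, MulChar.one_apply hc.isUnit,
    hφc, sum_apply_cubic_eq hφ h2 ha]
  rw [hφ, map_pow] at hb2
  linear_combination (-(Fintype.card F - 1) * (2 + (ξ ^ 6) (-a))) * hb2

theorem card_affine_points [DecidableEq F] {φ : MulChar F ℂ} (hφ : orderOf φ = 2)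
    (h2 : (2 : F) ≠ 0) (f : F → F) :
    (#{P : F × F | P.2 ^ 2 = f P.1} : ℂ) = Fintype.card F + ∑ X, φ (f X) := by
  have h : #{P : F × F | P.2 ^ 2 = f P.1} = ∑ X, #{y | y ^ 2 = f X} := by
    simp only [card_filter, Fintype.sum_prod_type]
  rw [h]
  push_cast
  simp [card_sq_eq hφ h2, sum_add_distrib]

theorem orderOf_eq_card_sub_one {T : MulChar F ℂ}
    (hT : ∀ χ : MulChar F ℂ, ∃ k : ℕ, χ = T ^ k) : orderOf T = Fintype.card F - 1 := by
  rw [← card_mulChar_complex]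
  exact orderOf_eq_card_of_forall_mem_powers fun χ ↦ (hT χ).imp fun _ h ↦ h.symm

theorem sum_range_pow_eq_sum_mulChar [Fintype (MulChar F ℂ)] {T : MulChar F ℂ}
    (hT : ∀ χ : MulChar F ℂ, ∃ k : ℕ, χ = T ^ k) (f : MulChar F ℂ → ℂ) :
    ∑ m ∈ range (Fintype.card F - 1), f (T ^ m) = ∑ χ, f χ := by
  rw [← orderOf_eq_card_sub_one hT]
  refine sum_bij (fun m _ ↦ T ^ m) (by simp) ?_ ?_ (by simp)
  · intro m hm n hn h
    exact pow_injOn_Iio_orderOf (by simpa using hm) (by simpa using hn) h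
  · intro χ _
    obtain ⟨k, rfl⟩ := hT χ
    exact ⟨k % orderOf T, mem_range.mpr (Nat.mod_lt _ (orderOf_pos T)), pow_mod_orderOf T k⟩

end curve

section hypergeometric

theorem pow_three_apply_mul {F : Type*} [Field F] (ξ : MulChar F ℂ) (h2 : (2 : F) ≠ 0)
    (h3 : (3 : F) ≠ 0) {a : F} (ha : a ≠ 0) (b : F) :
    (ξ ^ 3) (a ^ 3 / 27) * (ξ (-1) * (ξ ^ 3) 4 * (ξ ^ 3) (-27 * b ^ 2 / (4 * a ^ 3))) =
      (ξ ^ 6) b := by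
  have h4 : (4 : F) ≠ 0 := by
    rw [show (4 : F) = 2 ^ 2 by norm_num]
    exact pow_ne_zero _ h2
  have h27 : (27 : F) ≠ 0 := by
    rw [show (27 : F) = 3 ^ 3 by norm_num]
    exact pow_ne_zero _ h3
  have h : a ^ 3 / 27 * (4 * (-27 * b ^ 2 / (4 * a ^ 3))) = -1 * b ^ 2 := by
    field_simp
  have h' := congrArg (fun x ↦ (ξ ^ 3) x) h
  simp only [map_mul (ξ ^ 3)] at h'
  have hs : ξ (-1) * (ξ ^ 3) (-1) = 1 := by
    rw [← MulChar.mul_apply, ← pow_succ', pow_four_apply_neg_one]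
  have hb2 : (ξ ^ 3) (b ^ 2) = (ξ ^ 6) b := by
    rw [map_pow, ← MulChar.pow_apply' _ two_ne_zero, ← pow_mul]
  rw [hb2] at h'
  linear_combination ξ (-1) * h' + (ξ ^ 6) b * hs

variable {F : Type} [Field F] [Fintype F]

theorem greeneBinom_mul_greeneBinom {ξ : MulChar F ℂ} (hξ : orderOf ξ = 12) (θ : MulChar F ℂ) :
    greeneBinom F (ξ * (ξ ^ 3 * θ)) (ξ ^ 3 * θ) *
        greeneBinom F (ξ ^ 5 * (ξ ^ 3 * θ)) (ξ ^ 6 * (ξ ^ 3 * θ)) =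
      jacobiSum (ξ ^ 4 * θ) (ξ ^ 9 * θ⁻¹) * jacobiSum (ξ ^ 8 * θ) (ξ ^ 3 * θ⁻¹) /
        (Fintype.card F : ℂ) ^ 2 := by
  have h12 : ξ ^ 12 = 1 := by rw [← hξ, pow_orderOf_eq_one]
  have e1 : ξ * (ξ ^ 3 * θ) = ξ ^ 4 * θ := by rw [← mul_assoc, ← pow_succ']
  have e2 : ξ ^ 5 * (ξ ^ 3 * θ) = ξ ^ 8 * θ := by rw [← mul_assoc, ← pow_add]
  have e3 : (ξ ^ 3 * θ)⁻¹ = ξ ^ 9 * θ⁻¹ := by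
    rw [mul_inv, inv_eq_of_mul_eq_one_right (b := ξ ^ 9) (by rw [← pow_add, h12])]
  have e4 : (ξ ^ 6 * (ξ ^ 3 * θ))⁻¹ = ξ ^ 3 * θ⁻¹ := by
    rw [mul_inv, e3, inv_eq_of_mul_eq_one_right (b := ξ ^ 6) (by rw [← pow_add, h12]), ← mul_assoc,
      ← pow_add, pow_add ξ 12 3, h12, one_mul]
  have hs := (ξ ^ 3 * θ).apply_neg_one_mul_self
  rw [greeneBinom, greeneBinom, e1, e2, e4, e3, MulChar.mul_apply (ξ ^ 6), pow_six_apply_neg_one,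
    one_mul]
  linear_combination (jacobiSum (ξ ^ 4 * θ) (ξ ^ 9 * θ⁻¹) *
    jacobiSum (ξ ^ 8 * θ) (ξ ^ 3 * θ⁻¹) / (Fintype.card F : ℂ) ^ 2) * hs

theorem hyp2F1_eq_sum_cubic [DecidableEq F] {T : MulChar F ℂ}
    (hT : ∀ χ : MulChar F ℂ, ∃ k : ℕ, χ = T ^ k) {ξ : MulChar F ℂ} (hξ : orderOf ξ = 12)
    (h2 : (2 : F) ≠ 0) (h3 : (3 : F) ≠ 0) {a b : F} (ha : a ≠ 0) (hb : b ≠ 0) :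
    (Fintype.card F : ℂ) * (ξ ^ 3) (a ^ 3 / 27) *
        hyp2F1 F (Fintype.card F) T ξ (ξ ^ 5) (ξ ^ 6) (-27 * b ^ 2 / (4 * a ^ 3)) =
      ∑ X, (ξ ^ 6) (X ^ 3 + a * X + b) := by
  classical
  have : Fintype (MulChar F ℂ) := Fintype.ofFinite _
  have hq : (Fintype.card F : ℂ) ≠ 0 := Nat.cast_ne_zero.mpr Fintype.card_ne_zero
  have hq1 : (Fintype.card F : ℂ) - 1 ≠ 0 := by
    rw [sub_ne_zero]
    exact_mod_cast Fintype.one_lt_card.ne'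
  have h4 : (4 : F) ≠ 0 := by
    rw [show (4 : F) = 2 ^ 2 by norm_num]
    exact pow_ne_zero _ h2
  have hz : 4 * (-27 * b ^ 2 / (4 * a ^ 3)) = -27 * b ^ 2 / a ^ 3 := by
    field_simp
  have hb2 : (ξ ^ 6) b * (ξ ^ 6) b = 1 := by
    rw [← map_mul, ← sq, MulChar.apply_sq_of_orderOf_eq_two (orderOf_pow_six hξ) hb]
  have hP := pow_three_apply_mul ξ h2 h3 ha b
  have hS := sum_bracket_eq hξ h2 h3 ha hb
  rw [hyp2F1, sum_range_pow_eq_sum_mulChar hT fun χ ↦ greeneBinom F (ξ * χ) χ *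
    greeneBinom F (ξ ^ 5 * χ) (ξ ^ 6 * χ) * χ (-27 * b ^ 2 / (4 * a ^ 3)),
    ← Equiv.sum_comp (Equiv.mulLeft (ξ ^ 3))]
  simp only [Equiv.coe_mulLeft, greeneBinom_mul_greeneBinom hξ,
    jacobiSum_mul_jacobiSum hξ h2 h3]
  rw [sum_congr rfl (g := fun θ ↦ ξ (-1) * (ξ ^ 3) 4 * (ξ ^ 3) (-27 * b ^ 2 / (4 * a ^ 3)) /
    (Fintype.card F : ℂ) ^ 2 * (θ (-27 * b ^ 2 / a ^ 3) *
      (θ⁻¹ 27 * jacobiSum θ⁻¹ (θ⁻¹ * θ⁻¹) * jacobiSum (θ * θ) (ξ ^ 6 * (θ * θ)⁻¹) +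
        (if θ = 1 then 2 * ((Fintype.card F : ℂ) - 1) else 0) +
        (if θ = ξ ^ 6 then (Fintype.card F : ℂ) - 1 else 0))))]
  swap
  · intro θ _
    rw [← hz, map_mul θ, MulChar.mul_apply]
    ring
  rw [← mul_sum, hS]
  clear hS hz
  generalize ∑ X, (ξ ^ 6) (X ^ 3 + a * X + b) = S
  generalize -27 * b ^ 2 / (4 * a ^ 3) = z at hP ⊢
  field_simp
  linear_combination (ξ ^ 6) b * S * hP + S * hb2

end hypergeometric

theorem natCast_ne_zero_of_lt_char {R : Type*} [NonAssocSemiring R] (p : ℕ) [CharP R p] {n : ℕ}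
    (h0 : n ≠ 0) (hn : n < p) : (n : R) ≠ 0 := by
  rw [Ne, CharP.cast_eq_zero_iff R p]
  exact Nat.not_dvd_of_pos_of_lt (Nat.pos_of_ne_zero h0) hn

end

/-- Lennon's formula: for `E : y² = x³ + ax + b` over `F_q`, `q ≡ 1 (mod 12)`,
`q = p^n`, `p > 3`, `j(E) ≠ 0, 1728`, the trace of Frobenius is
`a_q(E) = -q·T^{(q-1)/4}(a³/27)·₂F₁(T^{(q-1)/12}, T^{5(q-1)/12}; φ | -27b²/(4a³))`. -/
theorem trace_frobenius_elliptic (F : Type) [Field F] [Fintype F] [DecidableEq F]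
    (p n q : ℕ) [CharP F p] (hp : p.Prime) (hp3 : 3 < p) (hq : q = p ^ n)
    (hcard : Fintype.card F = q) (h12 : 12 ∣ q - 1)
    (T : MulChar F ℂ) (hT : ∀ χ : MulChar F ℂ, ∃ k : ℕ, χ = T ^ k)
    (a b : F) (ha : a ≠ 0) (hb : b ≠ 0) (hΔ : 4 * a ^ 3 + 27 * b ^ 2 ≠ 0) :
    (q : ℂ) - ((Finset.univ.filter
        (fun P : F × F => P.2 ^ 2 = P.1 ^ 3 + a * P.1 + b)).card : ℂ)
      = -(q : ℂ) * (T ^ ((q - 1) / 4)) (a ^ 3 / 27) *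
          hyp2F1 F q T (T ^ ((q - 1) / 12)) (T ^ (5 * (q - 1) / 12)) (T ^ ((q - 1) / 2))
            (-27 * b ^ 2 / (4 * a ^ 3)) := by
  subst hcard
  have h2 : (2 : F) ≠ 0 := by
    exact_mod_cast natCast_ne_zero_of_lt_char (R := F) p two_ne_zero (by omega)
  have h3 : (3 : F) ≠ 0 := by
    exact_mod_cast natCast_ne_zero_of_lt_char (R := F) p three_ne_zero hp3
  have hT' := orderOf_eq_card_sub_one hT
  have hpos : 0 < Fintype.card F - 1 := Nat.sub_pos_of_lt Fintype.one_lt_card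
  obtain ⟨k, hk⟩ := h12
  have hξ : orderOf (T ^ k) = 12 := by
    rw [orderOf_pow_of_dvd (by omega) (by rw [hT', hk]; exact dvd_mul_left _ _), hT', hk]
    exact Nat.mul_div_cancel _ (by omega)
  rw [show (Fintype.card F - 1) / 4 = k * 3 by omega,
    show (Fintype.card F - 1) / 12 = k by omega,
    show 5 * (Fintype.card F - 1) / 12 = k * 5 by omega,
    show (Fintype.card F - 1) / 2 = k * 6 by omega, pow_mul, pow_mul, pow_mul,
    card_affine_points (orderOf_pow_six hξ) h2 fun x ↦ x ^ 3 + a * x + b,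
    ← hyp2F1_eq_sum_cubic hT hξ h2 h3 ha hb]
  ring
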